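/- arXiv:1703.03691 — 8 statements merged into one kernel-verified Lean document; each statement's English description precedes it below -/
import Mathlib

section
/- Let N ≥ 2 be a natural number, let λ₂, …, λ_N be positive reals, and let f > 0, g ≥ 0, g₀ > 0, K_I > 0, c > 0 be reals. Define V = (1/(2N)) · Σₙ₌₂^N s(λₙ, c), where s(λ, c) = 1 / ( f·g·λ² + ( K_I·f·(g₀ + λ·(c+g)) + g₀·f·λ·(c²·λ + f + c·g₀) ) / ( f + c·g₀ + c·λ·(c+g) ) ). Then 0 < V < (f + c·g₀)/(2·K_I·f·g₀). -/
/-- Each mode's contribution is positive and strictly below its limiting value at `l = 0`. -/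
lemma dapi_mode_pos_and_lt {f g g0 KI c l : ℝ} (hf : 0 < f) (hg : 0 ≤ g) (hg0 : 0 < g0)
    (hKI : 0 < KI) (hc : 0 < c) (hl : 0 < l) :
    0 < 1 / (f * g * l ^ 2 +
        (KI * f * (g0 + l * (c + g)) + g0 * f * l * (c ^ 2 * l + f + c * g0)) /
          (f + c * g0 + c * l * (c + g))) ∧
    1 / (f * g * l ^ 2 +
        (KI * f * (g0 + l * (c + g)) + g0 * f * l * (c ^ 2 * l + f + c * g0)) /
          (f + c * g0 + c * l * (c + g))) < (f + c * g0) / (KI * f * g0) := by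
  refine ⟨by positivity, ?_⟩
  have h_lt : KI * f * g0 / (f + c * g0) <
      (KI * f * (g0 + l * (c + g)) + g0 * f * l * (c ^ 2 * l + f + c * g0)) /
        (f + c * g0 + c * l * (c + g)) := by
    rw [div_lt_div_iff₀ (by positivity) (by positivity)]
    have h_pos : 0 < KI * f * (l * (c + g)) * f +
        g0 * f * l * (c ^ 2 * l + f + c * g0) * (f + c * g0) := by positivity
    linear_combination h_pos
  have h_nonneg : 0 ≤ f * g * l ^ 2 := by positivity
  rw [← one_div_div (KI * f * g0) (f + c * g0)]
  exact one_div_lt_one_div_of_lt (by positivity) (by linarith)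

theorem stmt_5 (N : ℕ) (hN : 2 ≤ N) (lam : ℕ → ℝ)
    (hlam : ∀ n ∈ Finset.Icc 2 N, 0 < lam n)
    (f g g0 KI c : ℝ) (hf : 0 < f) (hg : 0 ≤ g) (hg0 : 0 < g0) (hKI : 0 < KI) (hc : 0 < c)
    (s : ℝ → ℝ → ℝ)
    (hs : ∀ lam c, s lam c =
      1 / (f * g * lam ^ 2 +
        (KI * f * (g0 + lam * (c + g)) + g0 * f * lam * (c ^ 2 * lam + f + c * g0)) /
          (f + c * g0 + c * lam * (c + g))))
    (V : ℝ) (hV : V = (1 / (2 * (N : ℝ))) * ∑ n ∈ Finset.Icc 2 N, s (lam n) c) :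
    0 < V ∧ V < (f + c * g0) / (2 * KI * f * g0) := by
  have h_mode : ∀ n ∈ Finset.Icc 2 N,
      0 < s (lam n) c ∧ s (lam n) c < (f + c * g0) / (KI * f * g0) := by
    intro n hn
    rw [hs]
    exact dapi_mode_pos_and_lt hf hg hg0 hKI hc (hlam n hn)
  have h_nonempty : (Finset.Icc 2 N).Nonempty := Finset.nonempty_Icc.mpr hN
  have hN_pos : (0 : ℝ) < N := by exact_mod_cast (by omega : 0 < N)
  have h_sum_pos := Finset.sum_pos (fun n hn => (h_mode n hn).1) h_nonempty
  have h_sum_lt : ∑ n ∈ Finset.Icc 2 N, s (lam n) c < N * ((f + c * g0) / (KI * f * g0)) := by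
    refine (Finset.sum_lt_sum_of_nonempty h_nonempty fun n hn => (h_mode n hn).2).trans_le ?_
    rw [Finset.sum_const, nsmul_eq_mul]
    gcongr
    rw [Nat.card_Icc]
    omega
  rw [hV]
  refine ⟨by positivity, ?_⟩
  calc 1 / (2 * (N : ℝ)) * ∑ n ∈ Finset.Icc 2 N, s (lam n) c
      < 1 / (2 * (N : ℝ)) * (N * ((f + c * g0) / (KI * f * g0))) := by gcongr
    _ = (f + c * g0) / (2 * KI * f * g0) := by field_simp
end

section
/- Let f > 0, g ≥ 0, g₀ > 0, K_I > 0, c > 0 be reals and define, for λ ≥ 0, s(λ) = 1 / ( f·g·λ² + ( K_I·f·(g₀ + λ·(c+g)) + g₀·f·λ·(c²·λ + f + c·g₀) ) / ( f + c·g₀ + c·λ·(c+g) ) ). Then s is strictly decreasing on [0, ∞); in particular s(0) = (f + c·g₀)/(K_I·f·g₀) and s(λ) < (f + c·g₀)/(K_I·f·g₀) for all λ > 0. -/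
theorem stmt_6 (f g g0 KI c : ℝ) (hf : 0 < f) (hg : 0 ≤ g) (hg0 : 0 < g0)
    (hKI : 0 < KI) (hc : 0 < c)
    (s : ℝ → ℝ)
    (hs : ∀ lam, s lam =
      1 / (f * g * lam ^ 2 +
        (KI * f * (g0 + lam * (c + g)) + g0 * f * lam * (c ^ 2 * lam + f + c * g0)) /
          (f + c * g0 + c * lam * (c + g)))) :
    StrictAntiOn s (Set.Ici 0) ∧ s 0 = (f + c * g0) / (KI * f * g0) ∧
      ∀ lam > 0, s lam < (f + c * g0) / (KI * f * g0) := by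
  have anti : StrictAntiOn s (Set.Ici 0) := by
    intro x hx y _ hxy
    have hx0 : 0 ≤ x := hx
    have hy0 : 0 < y := hx0.trans_lt hxy
    rw [hs x, hs y]
    apply one_div_lt_one_div_of_lt (by positivity)
    apply add_lt_add_of_le_of_lt (by gcongr)
    rw [div_lt_div_iff₀ (by positivity) (by positivity), ← sub_pos]
    have hyx : 0 < y - x := sub_pos.mpr hxy
    have key : 0 < (y - x) * (KI * f * (c + g) * f + g0 * f *
        ((f + c * g0) * c ^ 2 * (x + y) + (f + c * g0) ^ 2 + c ^ 3 * (c + g) * x * y)) := by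
      positivity
    refine key.trans_eq ?_
    ring
  have zero : s 0 = (f + c * g0) / (KI * f * g0) := by
    rw [hs 0]
    simp
  refine ⟨anti, zero, fun lam hlam => ?_⟩
  rw [← zero]
  exact anti Set.self_mem_Ici hlam.le hlam
end

section
/- Let λ > 0, f > 0, g ≥ 0, g₀ > 0, K_I > 0, c > 0 be reals, and let A be the 3×3 real matrix with rows (0, 1, 0), (−f·λ, −g·λ − g₀, K_I), and (0, −1, −c·λ). Then every complex eigenvalue of A has strictly negative real part. -/
/-- Roots of `z ((z + b) (z + d) + k) + a (z + d)` with positive coefficients lie in the open left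
half-plane: dividing by `z (z + d)` turns it into `z + b + k / (z + d) + a / z`, whose real part is
positive when `0 ≤ z.re`. -/
theorem re_neg_of_cubic_eq_zero {a b d k : ℝ} (ha : 0 < a) (hb : 0 < b) (hd : 0 < d) (hk : 0 < k)
    {z : ℂ} (hz : z * ((z + b) * (z + d) + k) + a * (z + d) = 0) : z.re < 0 := by
  by_contra! hre
  have hz0 : z ≠ 0 := by
    rintro rfl
    simp [ha.ne', hd.ne'] at hz
  have hzd : z + d ≠ 0 := by
    intro h
    have := congrArg Complex.re h
    simp at this
    linarith
  have hsum : z + b + k * (z + d)⁻¹ + a * z⁻¹ = 0 := by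
    field_simp
    linear_combination hz
  have hsum_re := congrArg Complex.re hsum
  simp only [Complex.add_re, Complex.re_ofReal_mul, Complex.inv_re, Complex.ofReal_re,
    Complex.zero_re] at hsum_re
  have h₁ : 0 ≤ k * ((z.re + d) / Complex.normSq (z + d)) :=
    mul_nonneg hk.le (div_nonneg (by linarith) (Complex.normSq_nonneg _))
  have h₂ : 0 ≤ a * (z.re / Complex.normSq z) :=
    mul_nonneg ha.le (div_nonneg hre (Complex.normSq_nonneg _))
  linarith

theorem stmt_8 (lam f g g0 KI c : ℝ) (hlam : 0 < lam) (hf : 0 < f) (hg : 0 ≤ g)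
    (hg0 : 0 < g0) (hKI : 0 < KI) (hc : 0 < c)
    (A : Matrix (Fin 3) (Fin 3) ℝ)
    (hA : A = !![0, 1, 0; -(f * lam), -(g * lam) - g0, KI; 0, -1, -(c * lam)]) :
    ∀ z ∈ spectrum ℂ (A.map (Complex.ofReal : ℝ → ℂ)), z.re < 0 := by
  intro z hz
  rw [spectrum.mem_iff, Matrix.isUnit_iff_isUnit_det, isUnit_iff_ne_zero, not_not, hA,
    Matrix.det_fin_three] at hz
  simp [Matrix.algebraMap_matrix_apply] at hz
  refine re_neg_of_cubic_eq_zero (a := f * lam) (b := g * lam + g0) (d := c * lam) (k := KI)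
    (by positivity) (by positivity) (by positivity) hKI ?_
  push_cast
  linear_combination hz
end

section
/- Let λ > 0, f₀ > 0, f ≥ 0, g ≥ 0, K_D > 0, τ > 0 be reals. Then every complex root ξ of the cubic polynomial ξ³ + (g·λ + 1/τ)·ξ² + ( (K_D + g·λ)/τ + f₀ + f·λ )·ξ + (f₀ + f·λ)/τ satisfies Re(ξ) < 0. -/
/-- The Routh–Hurwitz criterion for real monic cubics, in the sufficient direction. -/
theorem re_neg_of_cubic_root {a b c : ℝ} (ha : 0 < a) (hb : 0 < b) (hc : 0 < c)
    (hab : c < a * b) {z : ℂ} (hz : z ^ 3 + (a : ℂ) * z ^ 2 + (b : ℂ) * z + (c : ℂ) = 0) :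
    z.re < 0 := by
  obtain ⟨x, y⟩ := z
  have hre := congrArg Complex.re hz
  have him := congrArg Complex.im hz
  simp only [pow_succ, pow_zero, one_mul, Complex.add_re, Complex.add_im, Complex.mul_re,
    Complex.mul_im, Complex.ofReal_re, Complex.ofReal_im, Complex.zero_re,
    Complex.zero_im] at hre him
  change x < 0
  by_contra! hx
  have him' : y * (3 * x ^ 2 - y ^ 2 + 2 * a * x + b) = 0 := by linear_combination him
  rcases mul_eq_zero.mp him' with rfl | hy
  · have hpos : 0 < x ^ 3 + a * x ^ 2 + b * x + c := by positivity
    linarith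
  · have hnonneg : 0 ≤ 8 * x ^ 3 + 8 * a * x ^ 2 + 2 * a ^ 2 * x + 2 * b * x := by positivity
    have hsum : 8 * x ^ 3 + 8 * a * x ^ 2 + 2 * a ^ 2 * x + 2 * b * x + (a * b - c) = 0 := by
      linear_combination (3 * x + a) * hy - hre
    linarith

theorem stmt_10 (lam f0 f g KD tau : ℝ) (hlam : 0 < lam) (hf0 : 0 < f0) (hf : 0 ≤ f)
    (hg : 0 ≤ g) (hKD : 0 < KD) (htau : 0 < tau) (z : ℂ)
    (hz : z ^ 3 + ((g * lam + 1 / tau : ℝ) : ℂ) * z ^ 2 +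
        (((KD + g * lam) / tau + f0 + f * lam : ℝ) : ℂ) * z +
        (((f0 + f * lam) / tau : ℝ) : ℂ) = 0) :
    z.re < 0 := by
  refine re_neg_of_cubic_root (by positivity) (by positivity) (by positivity) ?_ hz
  have hpos : 0 < g * lam * ((KD + g * lam) / tau + f0 + f * lam) +
      1 / tau * ((KD + g * lam) / tau) := by positivity
  linear_combination hpos
end

section
/- Let N ≥ 2 be a natural number, let λ₂, …, λ_N be positive reals, and let f₀ > 0, f ≥ 0, g ≥ 0, K_D > 0, τ > 0 be reals. Define V = (1/(2N)) · Σₙ₌₂^N sF(λₙ, τ), where sF(λ, τ) = 1 / ( (f₀ + f·λ) · ( g·λ + K_D·(τ·g·λ + 1) / ( τ²·(f₀ + f·λ) + τ·g·λ + 1 ) ) ). Then 0 < V < (τ²·f₀ + 1)/(2·f₀·K_D). -/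
/-- The squared norm of a mode with stiffness `a` and relative damping `b` is positive. -/
theorem mode_norm_pos {a b K t : ℝ} (ha : 0 < a) (hb : 0 ≤ b) (hK : 0 < K) (ht : 0 ≤ t) :
    0 < 1 / (a * (b + K * (t * b + 1) / (t ^ 2 * a + t * b + 1))) := by
  positivity

/-- The squared norm of a mode with stiffness `a ≥ a₀` and relative damping `b ≥ 0` is at most
that of a mode with stiffness `a₀` and no relative damping. -/
theorem mode_norm_le {a₀ a b K t : ℝ} (ha₀ : 0 < a₀) (ha : a₀ ≤ a) (hb : 0 ≤ b) (hK : 0 < K)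
    (ht : 0 ≤ t) :
    1 / (a * (b + K * (t * b + 1) / (t ^ 2 * a + t * b + 1))) ≤
      (t ^ 2 * a₀ + 1) / (a₀ * K) := by
  have ha' : 0 < a := ha₀.trans_le ha
  have htb : 0 ≤ t * b := mul_nonneg ht hb
  have hd : 0 < t ^ 2 * a + t * b + 1 := by positivity
  have hfrac : a₀ * K ≤
      (t ^ 2 * a₀ + 1) * (a * (K * (t * b + 1) / (t ^ 2 * a + t * b + 1))) := by
    rw [← mul_div_assoc, ← mul_div_assoc, le_div_iff₀ hd]
    have h₁ : 0 ≤ K * (t * b + 1) * (a - a₀) :=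
      mul_nonneg (by positivity) (sub_nonneg.2 ha)
    have h₂ : 0 ≤ K * (t ^ 2 * a₀ * a * (t * b)) := by positivity
    linarith
  have hdamp : 0 ≤ (t ^ 2 * a₀ + 1) * (a * b) := by positivity
  rw [div_le_div_iff₀ (by positivity) (by positivity)]
  linarith

theorem stmt_11 (N : ℕ) (hN : 2 ≤ N) (lam : ℕ → ℝ)
    (hlam : ∀ n ∈ Finset.Icc 2 N, 0 < lam n)
    (f0 f g KD tau : ℝ) (hf0 : 0 < f0) (hf : 0 ≤ f) (hg : 0 ≤ g) (hKD : 0 < KD)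
    (htau : 0 < tau)
    (sF : ℝ → ℝ → ℝ)
    (hsF : ∀ lam tau, sF lam tau =
      1 / ((f0 + f * lam) *
        (g * lam + KD * (tau * g * lam + 1) / (tau ^ 2 * (f0 + f * lam) + tau * g * lam + 1))))
    (V : ℝ) (hV : V = (1 / (2 * (N : ℝ))) * ∑ n ∈ Finset.Icc 2 N, sF (lam n) tau) :
    0 < V ∧ V < (tau ^ 2 * f0 + 1) / (2 * f0 * KD) := by
  have hmode : ∀ n ∈ Finset.Icc 2 N, 0 < sF (lam n) tau ∧
      sF (lam n) tau ≤ (tau ^ 2 * f0 + 1) / (f0 * KD) := by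
    intro n hn
    have hl := (hlam n hn).le
    have hfl : 0 ≤ f * lam n := mul_nonneg hf hl
    have hgl : 0 ≤ g * lam n := mul_nonneg hg hl
    rw [hsF, mul_assoc tau]
    exact ⟨mode_norm_pos (by linarith) hgl hKD htau.le,
      mode_norm_le hf0 (by linarith) hgl hKD htau.le⟩
  have hN0 : (0 : ℝ) < N := by exact_mod_cast (by omega : 0 < N)
  have hne : (Finset.Icc 2 N).Nonempty := Finset.nonempty_Icc.2 hN
  subst hV
  refine ⟨mul_pos (by positivity) (Finset.sum_pos (fun n hn => (hmode n hn).1) hne), ?_⟩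
  have hsum := Finset.sum_le_card_nsmul _ _ _ fun n hn => (hmode n hn).2
  have hcard : ((Finset.Icc 2 N).card : ℝ) < N := by
    rw [Nat.card_Icc]
    exact_mod_cast (by omega : N + 1 - 2 < N)
  rw [nsmul_eq_mul] at hsum
  calc (1 / (2 * (N : ℝ))) * ∑ n ∈ Finset.Icc 2 N, sF (lam n) tau
      < (1 / (2 * (N : ℝ))) * (N * ((tau ^ 2 * f0 + 1) / (f0 * KD))) :=
        mul_lt_mul_of_pos_left
          (hsum.trans_lt (mul_lt_mul_of_pos_right hcard (by positivity))) (by positivity)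
    _ = (tau ^ 2 * f0 + 1) / (2 * f0 * KD) := by field_simp
end

section
/- Let f₀ > 0, f ≥ 0, g ≥ 0, K_D > 0, τ > 0 be reals and define, for λ ≥ 0, sF(λ) = 1 / ( (f₀ + f·λ) · ( g·λ + K_D·(τ·g·λ + 1) / ( τ²·(f₀ + f·λ) + τ·g·λ + 1 ) ) ). Then sF is (weakly) decreasing on [0, ∞), sF(0) = (τ²·f₀ + 1)/(f₀·K_D), and sF(λ) ≤ (τ²·f₀ + 1)/(f₀·K_D) for all λ > 0. -/
/-- The weighted harmonic mean `p * u / (c * p + u)` is monotone in both arguments. -/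
lemma mul_div_mul_add_le_mul_div_mul_add {c p p' u u' : ℝ} (hc : 0 ≤ c) (hp : 0 < p) (hu : 0 < u)
    (hpp : p ≤ p') (huu : u ≤ u') : p * u / (c * p + u) ≤ p' * u' / (c * p' + u') := by
  have hp' : 0 < p' := hp.trans_le hpp
  have hu' : 0 < u' := hu.trans_le huu
  rw [div_le_div_iff₀ (by positivity) (by positivity)]
  have h₁ : 0 ≤ c * p * p' * (u' - u) := mul_nonneg (by positivity) (sub_nonneg.2 huu)
  have h₂ : 0 ≤ u * u' * (p' - p) := mul_nonneg (by positivity) (sub_nonneg.2 hpp)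
  linarith

theorem stmt_12 (f0 f g KD tau : ℝ) (hf0 : 0 < f0) (hf : 0 ≤ f) (hg : 0 ≤ g)
    (hKD : 0 < KD) (htau : 0 < tau)
    (sF : ℝ → ℝ)
    (hsF : ∀ lam, sF lam =
      1 / ((f0 + f * lam) *
        (g * lam + KD * (tau * g * lam + 1) / (tau ^ 2 * (f0 + f * lam) + tau * g * lam + 1)))) :
    AntitoneOn sF (Set.Ici 0) ∧ sF 0 = (tau ^ 2 * f0 + 1) / (f0 * KD) ∧
      ∀ lam > 0, sF lam ≤ (tau ^ 2 * f0 + 1) / (f0 * KD) := by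
  have hanti : AntitoneOn sF (Set.Ici 0) := by
    intro a ha b hb hab
    rw [Set.mem_Ici] at ha hb
    have hsplit : ∀ x : ℝ, (f0 + f * x) *
        (g * x + KD * (tau * g * x + 1) / (tau ^ 2 * (f0 + f * x) + tau * g * x + 1)) =
        (f0 + f * x) * (g * x) + KD * ((f0 + f * x) * (tau * g * x + 1) /
          (tau ^ 2 * (f0 + f * x) + (tau * g * x + 1))) := by
      intro x
      rw [← add_assoc]
      ring
    rw [hsF, hsF]
    apply one_div_le_one_div_of_le (by positivity)
    rw [hsplit, hsplit]
    have hharm := mul_div_mul_add_le_mul_div_mul_add (c := tau ^ 2) (p := f0 + f * a)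
      (p' := f0 + f * b) (u := tau * g * a + 1) (u' := tau * g * b + 1)
      (by positivity) (by positivity) (by positivity) (by gcongr) (by gcongr)
    gcongr
  have hzero : sF 0 = (tau ^ 2 * f0 + 1) / (f0 * KD) := by
    rw [hsF]
    simp only [mul_zero, add_zero, zero_add, mul_one]
    field_simp
  exact ⟨hanti, hzero, fun lam hlam =>
    hzero ▸ hanti Set.self_mem_Ici (Set.mem_Ici.2 hlam.le) hlam.le⟩
end

section
/- Let N ≥ 2 be a natural number, let λ₂, …, λ_N be positive reals, and let f₀ > 0, f ≥ 0, g ≥ 0, K_D > 0 be reals. Define, for τ ≥ 0, V(τ) = (1/(2N)) · Σₙ₌₂^N sF(λₙ, τ), where sF(λ, τ) = 1 / ( (f₀ + f·λ) · ( g·λ + K_D·(τ·g·λ + 1) / ( τ²·(f₀ + f·λ) + τ·g·λ + 1 ) ) ). Then V is strictly increasing on [0, ∞); in particular V is minimized over τ ≥ 0 at τ = 0, where V(0) = (1/(2N)) · Σₙ₌₂^N 1/((f₀ + f·λₙ)(g·λₙ + K_D)). -/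
/-- The filtered derivative gain `K (τ b + 1) / (τ² a + τ b + 1)` is strictly decreasing in the
filter time constant `τ ≥ 0`. -/
lemma filteredGain_strictAntiOn {a b K : ℝ} (ha : 0 < a) (hb : 0 ≤ b) (hK : 0 < K) :
    StrictAntiOn (fun t : ℝ => K * (t * b + 1) / (t ^ 2 * a + t * b + 1)) (Set.Ici 0) := by
  intro s hs t ht hst
  have hs' : (0 : ℝ) ≤ s := hs
  have ht' : (0 : ℝ) ≤ t := ht
  have key : 0 < (t - s) * (t * s * b + (t + s)) :=
    mul_pos (by linarith) (by nlinarith [mul_nonneg (mul_nonneg ht' hs') hb])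
  have key' := mul_pos (mul_pos hK ha) key
  change K * (t * b + 1) / (t ^ 2 * a + t * b + 1) < K * (s * b + 1) / (s ^ 2 * a + s * b + 1)
  rw [div_lt_div_iff₀ (by positivity) (by positivity)]
  linear_combination key'

/-- Each modal contribution to the variance is strictly increasing in the filter time constant. -/
lemma modalVariance_strictMonoOn {a b K : ℝ} (ha : 0 < a) (hb : 0 ≤ b) (hK : 0 < K) :
    StrictMonoOn
      (fun t : ℝ => 1 / (a * (b + K * (t * b + 1) / (t ^ 2 * a + t * b + 1)))) (Set.Ici 0) := by
  intro s hs t ht hst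
  have ht' : (0 : ℝ) ≤ t := ht
  have h := filteredGain_strictAntiOn ha hb hK hs ht hst
  exact one_div_lt_one_div_of_lt (by positivity)
    (mul_lt_mul_of_pos_left (add_lt_add_right h b) ha)

theorem stmt_17 (N : ℕ) (hN : 2 ≤ N) (lam : ℕ → ℝ)
    (hlam : ∀ n ∈ Finset.Icc 2 N, 0 < lam n)
    (f0 f g KD : ℝ) (hf0 : 0 < f0) (hf : 0 ≤ f) (hg : 0 ≤ g) (hKD : 0 < KD)
    (sF : ℝ → ℝ → ℝ)
    (hsF : ∀ lam tau, sF lam tau =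
      1 / ((f0 + f * lam) *
        (g * lam + KD * (tau * g * lam + 1) / (tau ^ 2 * (f0 + f * lam) + tau * g * lam + 1))))
    (V : ℝ → ℝ)
    (hV : ∀ tau, V tau = (1 / (2 * (N : ℝ))) * ∑ n ∈ Finset.Icc 2 N, sF (lam n) tau) :
    StrictMonoOn V (Set.Ici 0) ∧ (∀ tau ≥ (0 : ℝ), V 0 ≤ V tau) ∧
      V 0 = (1 / (2 * (N : ℝ))) *
        ∑ n ∈ Finset.Icc 2 N, 1 / ((f0 + f * lam n) * (g * lam n + KD)) := by
  have hmono : StrictMonoOn V (Set.Ici 0) := by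
    intro s hs t ht hst
    rw [hV, hV]
    have hN' : (0 : ℝ) < 1 / (2 * (N : ℝ)) := by
      have : (0 : ℝ) < N := by exact_mod_cast (by omega : 0 < N)
      positivity
    refine mul_lt_mul_of_pos_left ?_ hN'
    refine Finset.sum_lt_sum_of_nonempty ⟨2, Finset.mem_Icc.2 ⟨le_rfl, hN⟩⟩ fun n hn => ?_
    have hl := hlam n hn
    have h := modalVariance_strictMonoOn (a := f0 + f * lam n) (b := g * lam n)
      (by positivity) (by positivity) hKD hs ht hst
    simpa only [hsF, mul_assoc] using h
  refine ⟨hmono, fun t ht => hmono.monotoneOn Set.self_mem_Ici ht ht, ?_⟩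
  simp [hV, hsF]
end

section
/- Let λ > 0, f₀ > 0, f ≥ 0, g ≥ 0, K_D > 0 be reals, and define, for τ ≥ 0, sF(τ) = 1 / ( (f₀ + f·λ) · ( g·λ + K_D·(τ·g·λ + 1) / ( τ²·(f₀ + f·λ) + τ·g·λ + 1 ) ) ). Then the derivative of sF satisfies sF′(0) = 0 and sF′(τ) > 0 for every τ > 0. -/
/-- The derivative of the per-mode performance, with `a = f₀ + f λ` and `b = g λ`. -/
theorem hasDerivAt_modePerformance {a b k t : ℝ} (ha : 0 < a) (hb : 0 ≤ b) (hk : 0 < k)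
    (ht : 0 ≤ t) :
    HasDerivAt (fun s : ℝ => 1 / (a * (b + k * (s * b + 1) / (s ^ 2 * a + s * b + 1))))
      (k * (b * t ^ 2 + 2 * t) /
        (b * (t ^ 2 * a + t * b + 1) + k * (t * b + 1)) ^ 2) t := by
  have hD : 0 < t ^ 2 * a + t * b + 1 := by positivity
  have hM : 0 < b * (t ^ 2 * a + t * b + 1) + k * (t * b + 1) := by positivity
  have hQ : a * (b + k * (t * b + 1) / (t ^ 2 * a + t * b + 1)) ≠ 0 := by positivity
  have hlin : HasDerivAt (fun s : ℝ => s * b) b t := by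
    simpa using (hasDerivAt_id t).mul_const b
  have hsq : HasDerivAt (fun s : ℝ => s ^ 2 * a) (2 * t * a) t := by
    simpa using (hasDerivAt_pow 2 t).mul_const a
  have hquot := ((hlin.add_const 1).const_mul k).fun_div ((hsq.fun_add hlin).add_const 1) hD.ne'
  have h := (hasDerivAt_const t (1 : ℝ)).fun_div ((hquot.const_add b).const_mul a) hQ
  refine h.congr_deriv ?_
  have hQ' : b + k * (t * b + 1) / (t ^ 2 * a + t * b + 1) =
      (b * (t ^ 2 * a + t * b + 1) + k * (t * b + 1)) / (t ^ 2 * a + t * b + 1) := by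
    field_simp
  rw [hQ']
  field_simp
  ring

theorem stmt_18 (lam f0 f g KD : ℝ) (hlam : 0 < lam) (hf0 : 0 < f0) (hf : 0 ≤ f)
    (hg : 0 ≤ g) (hKD : 0 < KD)
    (sF : ℝ → ℝ)
    (hsF : ∀ tau, sF tau =
      1 / ((f0 + f * lam) *
        (g * lam + KD * (tau * g * lam + 1) / (tau ^ 2 * (f0 + f * lam) + tau * g * lam + 1)))) :
    deriv sF 0 = 0 ∧ ∀ tau > (0 : ℝ), 0 < deriv sF tau := by
  have ha : 0 < f0 + f * lam := by positivity
  have hb : 0 ≤ g * lam := by positivity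
  obtain rfl : sF = fun s => 1 / ((f0 + f * lam) * (g * lam + KD * (s * (g * lam) + 1) /
      (s ^ 2 * (f0 + f * lam) + s * (g * lam) + 1))) := by
    funext s
    rw [hsF s, mul_assoc s g lam]
  refine ⟨?_, fun t ht => ?_⟩
  · rw [(hasDerivAt_modePerformance ha hb hKD le_rfl).deriv]
    simp
  · rw [(hasDerivAt_modePerformance ha hb hKD ht.le).deriv]
    have ht' : 0 < t := ht
    positivity
end
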